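/- Let K ≥ 1 be a fixed integer. For the random walk on the spider SP(K), almost surely limsup_{n→∞} M_K(n) / √(2 n log log n) = 1, where M_K(n) = max_{1 ≤ j ≤ K} M_K(n,j) is the maximal height reached on any leg in the first n steps. -/

import Mathlib

open MeasureTheory Filter

/-- The vertex set of the spider `SP(N)`: the body, and points on the legs.
`leg r j` denotes the vertex of height `r + 1` on leg `j`. -/
inductive SpiderV (N : ℕ) where
  | body : SpiderV N
  | leg : ℕ → Fin N → SpiderV N
deriving DecidableEq

instance (N : ℕ) : MeasurableSpace (SpiderV N) := ⊤

/-- The one-step transition probabilities of the random walk on the spider `SP(N)`: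
from the body it moves to height `1` of each leg with probability `1/N`; from a vertex
of height `r ≥ 1` on a leg it moves up or down that leg with probability `1/2` each
(height `0` being the body). -/
noncomputable def spiderKernel (N : ℕ) : SpiderV N → SpiderV N → ENNReal
  | .body, .leg 0 _ => 1 / N
  | .leg 0 _, .body => 1 / 2
  | .leg r j, .leg r' j' => if j = j' ∧ (r' = r + 1 ∨ r = r' + 1) then 1 / 2 else 0
  | _, _ => 0

/-- The height of a vertex of the spider: the body has height `0` and `leg r j` has
height `r + 1`. -/
def spiderHeight {N : ℕ} : SpiderV N → ℕ
  | .body => 0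
  | .leg r _ => r + 1

set_option linter.unusedSectionVars false

/-- One-step operator of the height chain. -/
noncomputable def hT (f : ℕ → ℝ) : ℕ → ℝ
  | 0 => f 1
  | (r + 1) => (f r + f (r + 2)) / 2

lemma hT_mono {f g : ℕ → ℝ} (h : ∀ r, f r ≤ g r) (r : ℕ) : hT f r ≤ hT g r := by
  cases r with
  | zero => exact h 1
  | succ r => simp only [hT]; linarith [h r, h (r + 2)]

lemma hT_cosh (c x : ℝ) (r : ℕ) :
    hT (fun r => c * Real.cosh (x * r)) r = c * Real.cosh x * Real.cosh (x * r) := by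
  cases r with
  | zero => simp [hT]
  | succ r =>
    simp only [hT]
    have e1 : x * (r : ℝ) = x * ((r + 1 : ℕ) : ℝ) - x := by push_cast; ring
    have e2 : x * ((r + 2 : ℕ) : ℝ) = x * ((r + 1 : ℕ) : ℝ) + x := by push_cast; ring
    rw [e1, e2, Real.cosh_add, Real.cosh_sub]; ring

/-- Survival probability: the chain started at `r` stays strictly below `a` for `l` steps. -/
noncomputable def surv (a : ℝ) : ℕ → ℕ → ℝ
  | 0, r => if (r : ℝ) < a then 1 else 0
  | (l + 1), r => if (r : ℝ) < a then hT (surv a l) r else 0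

lemma surv_nonneg (a : ℝ) (l r : ℕ) : 0 ≤ surv a l r := by
  induction l generalizing r with
  | zero => simp only [surv]; split_ifs <;> norm_num
  | succ l ih =>
    simp only [surv]; split_ifs
    · cases r with
      | zero => exact ih 1
      | succ r => simp only [hT]; linarith [ih r, ih (r + 2)]
    · exact le_rfl

lemma surv_le_one (a : ℝ) (l r : ℕ) : surv a l r ≤ 1 := by
  induction l generalizing r with
  | zero => simp only [surv]; split_ifs <;> norm_num
  | succ l ih =>
    simp only [surv]; split_ifs
    · cases r with
      | zero => exact ih 1
      | succ r => simp only [hT]; linarith [ih r, ih (r + 2)]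
    · norm_num

lemma surv_succ_le (a : ℝ) (l r : ℕ) : surv a (l + 1) r ≤ surv a l r := by
  induction l generalizing r with
  | zero =>
    simp only [surv]; split_ifs
    · cases r with
      | zero => exact surv_le_one a 0 1
      | succ r =>
        have h1 := surv_le_one a 0 r
        have h2 := surv_le_one a 0 (r + 2)
        simp only [hT]
        simp only [surv] at h1 h2
        linarith
    · norm_num
  | succ l ih =>
    rw [surv, surv]; split_ifs
    · exact hT_mono ih r
    · norm_num

lemma surv_anti (a : ℝ) (l r : ℕ) : surv a l (r + 1) ≤ surv a l r := by
  induction l generalizing r with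
  | zero =>
    simp only [surv]
    split_ifs with h1 h2
    · norm_num
    · push_cast at h1; linarith
    · norm_num
    · norm_num
  | succ l ih =>
    by_cases h1 : ((r + 1 : ℕ) : ℝ) < a
    · have h2 : (r : ℝ) < a := by push_cast at h1; linarith
      cases r with
      | zero =>
        refine (surv_succ_le a l (0 + 1)).trans ?_
        rw [surv, if_pos h2]; simp [hT]
      | succ r =>
        rw [surv, surv, if_pos h1, if_pos h2]
        simp only [hT]
        linarith [ih r, ih (r + 2)]
    · rw [surv, if_neg h1]; exact surv_nonneg _ _ _

lemma surv_le_zero (a : ℝ) (l r : ℕ) : surv a l r ≤ surv a l 0 := by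
  induction r with
  | zero => exact le_rfl
  | succ r ih => exact (surv_anti a l r).trans ih

lemma surv_lower (a x : ℝ) (ha : 0 ≤ a) (l r : ℕ) :
    1 - Real.cosh x ^ l / Real.cosh (x * a) * Real.cosh (x * r) ≤ surv a l r := by
  have key : ∀ l : ℕ, ∀ r : ℕ, ¬ ((r : ℝ) < a) →
      1 - Real.cosh x ^ l / Real.cosh (x * a) * Real.cosh (x * r) ≤ 0 := by
    intro l r h
    have h1 : Real.cosh (x * a) ≤ Real.cosh (x * r) := by
      rw [Real.cosh_le_cosh, abs_mul, abs_mul, abs_of_nonneg ha,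
        abs_of_nonneg (Nat.cast_nonneg r : (0 : ℝ) ≤ r)]
      exact mul_le_mul_of_nonneg_left (not_lt.1 h) (abs_nonneg x)
    have h2 : 1 ≤ Real.cosh x ^ l := one_le_pow₀ (Real.one_le_cosh x)
    have h3 := Real.cosh_pos (x * a)
    have : 1 ≤ Real.cosh x ^ l / Real.cosh (x * a) * Real.cosh (x * r) := by
      rw [div_mul_eq_mul_div, le_div_iff₀ h3]
      nlinarith
    linarith
  induction l generalizing r with
  | zero =>
    simp only [surv]; split_ifs with h
    · have := Real.cosh_pos (x * a); have := Real.cosh_pos (x * r)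
      have : 0 ≤ Real.cosh x ^ 0 / Real.cosh (x * a) * Real.cosh (x * r) := by positivity
      linarith
    · exact key 0 r h
  | succ l ih =>
    rw [surv]; split_ifs with h
    · refine le_trans (le_of_eq ?_) (hT_mono ih r)
      have := hT_cosh (Real.cosh x ^ l / Real.cosh (x * a)) x r
      rw [pow_succ, mul_div_right_comm, ← this]
      cases r with
      | zero => simp [hT]
      | succ r => simp only [hT]; ring
    · exact key _ r h

/-- Upper bound on survival by a test function of cosh type. -/
lemma surv_upper (a c1 c2 c3 x1 x2 x3 : ℝ)
    (h1 : ∀ r : ℕ, c1 * Real.cosh (x1 * r) + c2 * Real.cosh (x2 * r) + c3 * Real.cosh (x3 * r) ≤ 1)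
    (h0 : ∀ r : ℕ, (r : ℝ) < a →
      c1 * Real.cosh (x1 * r) + c2 * Real.cosh (x2 * r) + c3 * Real.cosh (x3 * r) ≤ 0) (l : ℕ) :
    surv a l 0 ≤ 1 - (c1 * Real.cosh x1 ^ l + c2 * Real.cosh x2 ^ l + c3 * Real.cosh x3 ^ l) := by
  set g : ℕ → ℕ → ℝ := fun l r => c1 * Real.cosh x1 ^ l * Real.cosh (x1 * r)
    + c2 * Real.cosh x2 ^ l * Real.cosh (x2 * r) + c3 * Real.cosh x3 ^ l * Real.cosh (x3 * r) with hg
  have hstep : ∀ l r, hT (g l) r = g (l + 1) r := by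
    intro l r
    have e1 := hT_cosh (c1 * Real.cosh x1 ^ l) x1 r
    have e2 := hT_cosh (c2 * Real.cosh x2 ^ l) x2 r
    have e3 := hT_cosh (c3 * Real.cosh x3 ^ l) x3 r
    have : hT (g l) r = hT (fun r : ℕ => c1 * Real.cosh x1 ^ l * Real.cosh (x1 * r)) r
       + hT (fun r : ℕ => c2 * Real.cosh x2 ^ l * Real.cosh (x2 * r)) r
       + hT (fun r : ℕ => c3 * Real.cosh x3 ^ l * Real.cosh (x3 * r)) r := by
      cases r with
      | zero => simp [hT, hg]
      | succ r => simp only [hT, hg]; ring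
    rw [this, e1, e2, e3]; simp only [hg]; ring
  have hle : ∀ l r, g l r ≤ 1 := by
    intro l
    induction l with
    | zero => intro r; simpa [hg] using h1 r
    | succ l ih =>
      intro r; rw [← hstep]
      refine (hT_mono ih r).trans (le_of_eq ?_)
      cases r <;> simp [hT]
  have hmain : ∀ l r, surv a l r ≤ 1 - g l r := by
    intro l
    induction l with
    | zero =>
      intro r
      rw [surv]
      split_ifs with h
      · have := h0 r h
        have e : g 0 r ≤ 0 := by simpa [hg] using this
        linarith
      · linarith [hle 0 r]
    | succ l ih =>
      intro r
      rw [surv]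
      split_ifs with h
      · refine (hT_mono ih r).trans (le_of_eq ?_)
        rw [← hstep]
        cases r with
        | zero => simp [hT]
        | succ r => simp only [hT]; ring
      · linarith [hle (l + 1) r]
  simpa [hg] using hmain l 0

lemma exp_le_two_cosh (y : ℝ) : Real.exp y ≤ 2 * Real.cosh y := by
  rw [Real.cosh_eq]; linarith [Real.exp_pos (-y)]

lemma cosh_le_exp_of_nonneg {y : ℝ} (hy : 0 ≤ y) : Real.cosh y ≤ Real.exp y := by
  rw [Real.cosh_eq]
  have : Real.exp (-y) ≤ Real.exp y := Real.exp_le_exp.2 (by linarith)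
  linarith

lemma exp_le_cosh (y : ℝ) : Real.exp (y ^ 2 / 2 - y ^ 4 / 8) ≤ Real.cosh y := by
  have h1 : 1 + y ^ 2 / 2 ≤ Real.cosh y := by
    wlog hy : 0 ≤ y generalizing y
    · have := this (-y) (by linarith)
      simpa using this
    have h2 := Real.self_le_sinh_iff.2 (show 0 ≤ y / 2 by linarith)
    have h3 := Real.cosh_two_mul (y / 2)
    have h4 := Real.cosh_sq (y / 2)
    rw [mul_div_cancel₀ y two_ne_zero] at h3
    nlinarith
  refine le_trans ?_ h1
  have hu : 0 ≤ y ^ 2 / 2 := by positivity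
  rw [← Real.le_log_iff_exp_le (by linarith)]
  refine le_trans ?_ (Real.le_log_one_add_of_nonneg hu)
  rw [le_div_iff₀ (by linarith)]
  nlinarith [mul_nonneg hu (mul_nonneg hu hu)]

lemma surv_zero_lower (a z : ℝ) (ha : 0 ≤ a) (hz : 0 < z) (l : ℕ) (hl : (l : ℝ) ≤ z) :
    1 - 2 * Real.exp (- a ^ 2 / (2 * z)) ≤ surv a l 0 := by
  refine le_trans ?_ (surv_lower a (a / z) ha l 0)
  have h1 : Real.cosh (a / z) ^ l ≤ Real.exp (a ^ 2 / (2 * z)) := by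
    calc Real.cosh (a / z) ^ l ≤ Real.exp ((a / z) ^ 2 / 2) ^ l :=
          pow_le_pow_left₀ (Real.cosh_pos _).le (Real.cosh_le_exp_half_sq _) _
      _ = Real.exp (l * ((a / z) ^ 2 / 2)) := by rw [← Real.exp_nat_mul]
      _ ≤ Real.exp (z * ((a / z) ^ 2 / 2)) := by
          apply Real.exp_le_exp.2
          exact mul_le_mul_of_nonneg_right hl (by positivity)
      _ = _ := by congr 1; field_simp
  have h2 := exp_le_two_cosh (a / z * a)
  have h3 := Real.cosh_pos (a / z * a)
  have h4 : Real.cosh (a / z) ^ l / Real.cosh (a / z * a) ≤ 2 * Real.exp (- a ^ 2 / (2 * z)) := by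
    rw [div_le_iff₀ h3]
    have : Real.exp (a ^ 2 / (2 * z)) = Real.exp (- a ^ 2 / (2 * z)) * Real.exp (a / z * a) := by
      rw [← Real.exp_add]; congr 1; field_simp; ring
    have h5 := Real.exp_pos (- a ^ 2 / (2 * z))
    nlinarith
  simp only [Nat.cast_zero, mul_zero, Real.cosh_zero, mul_one]
  linarith

lemma surv_zero_upper (l : ℕ) (t d : ℝ) (hl : 0 < l) (ht : 0 < t) (hd : 0 < d) (hd1 : d ≤ 1)
    (hdt : 3 ≤ d ^ 2 * t) (htl : 8 * t ^ 2 ≤ l) :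
    surv (Real.sqrt (2 * l * t)) l 0 ≤ 1 - Real.exp (- ((1 + 2 * d) ^ 2 * t)) := by
  have hL : (0 : ℝ) < l := by exact_mod_cast hl
  obtain ⟨a, ha⟩ : ∃ a, a = Real.sqrt (2 * l * t) := ⟨_, rfl⟩
  have ha2 : a ^ 2 = 2 * l * t := by rw [ha, Real.sq_sqrt (by positivity)]
  have ha0 : 0 < a := by rw [ha]; positivity
  rw [← ha]
  obtain ⟨m, hm⟩ : ∃ m, m = a / l := ⟨_, rfl⟩
  have hm0 : 0 < m := by rw [hm]; positivity
  have hma : m * a = 2 * t := by rw [hm]; field_simp; rw [ha2]; ring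
  have hlm : l * m ^ 2 = 2 * t := by rw [hm]; field_simp; rw [ha2]; ring
  obtain ⟨D, hD⟩ : ∃ D, D = Real.exp (2 * t * (1 + d) * (1 + 2 * d)) := ⟨_, rfl⟩
  have hD0 : 0 < D := by rw [hD]; exact Real.exp_pos _
  have hcase1 : ∀ r : ℕ, (r : ℝ) < a → Real.cosh ((1 + d) * m * r) ≤
      2 * Real.exp (2 * d * t) * Real.cosh (m * r) := by
    intro r hr
    have := exp_le_two_cosh (m * r)
    have e := Real.exp_pos (2 * d * t)
    calc _ ≤ Real.exp ((1 + d) * m * r) := cosh_le_exp_of_nonneg (by positivity)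
      _ ≤ Real.exp (2 * d * t + m * r) := by
        apply Real.exp_le_exp.2
        have : d * (m * r) ≤ d * (m * a) := by gcongr
        rw [hma] at this; linarith
      _ = Real.exp (2 * d * t) * Real.exp (m * r) := Real.exp_add _ _
      _ ≤ _ := by nlinarith
  have hcase2 : ∀ r : ℕ, (1 + 2 * d) * a < r → Real.cosh ((1 + d) * m * r) ≤
      2 * Real.exp (- (2 * d * (1 + 2 * d) * t)) * Real.cosh ((1 + 2 * d) * m * r) := by
    intro r hr
    have := exp_le_two_cosh ((1 + 2 * d) * m * r)
    have e := Real.exp_pos (- (2 * d * (1 + 2 * d) * t))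
    calc _ ≤ Real.exp ((1 + d) * m * r) := cosh_le_exp_of_nonneg (by positivity)
      _ ≤ Real.exp (- (2 * d * (1 + 2 * d) * t) + (1 + 2 * d) * m * r) := by
        apply Real.exp_le_exp.2
        have : d * (m * ((1 + 2 * d) * a)) ≤ d * (m * r) := by gcongr
        have e : m * ((1 + 2 * d) * a) = (1 + 2 * d) * (2 * t) := by rw [← hma]; ring
        rw [e] at this; linarith
      _ = Real.exp (- (2 * d * (1 + 2 * d) * t)) * Real.exp ((1 + 2 * d) * m * r) := Real.exp_add _ _
      _ ≤ _ := by nlinarith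
  have hcase3 : ∀ r : ℕ, (r : ℝ) ≤ (1 + 2 * d) * a → Real.cosh ((1 + d) * m * r) ≤ D := by
    intro r hr
    calc _ ≤ Real.exp ((1 + d) * m * r) := cosh_le_exp_of_nonneg (by positivity)
      _ ≤ D := by
        rw [hD]
        apply Real.exp_le_exp.2
        calc (1 + d) * m * r ≤ (1 + d) * m * ((1 + 2 * d) * a) := by gcongr
          _ = (1 + d) * (1 + 2 * d) * (m * a) := by ring
          _ = _ := by rw [hma]; ring
  have hpos1 : ∀ r : ℕ, 0 ≤ 2 * Real.exp (2 * d * t) * Real.cosh (m * r) := fun r => by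
    have := Real.cosh_pos (m * r); positivity
  have hpos2 : ∀ r : ℕ, 0 ≤ 2 * Real.exp (- (2 * d * (1 + 2 * d) * t)) *
      Real.cosh ((1 + 2 * d) * m * r) := fun r => by
    have := Real.cosh_pos ((1 + 2 * d) * m * r); positivity
  have hform : ∀ x y z : ℝ, 1 / D * x + (- (2 * Real.exp (2 * d * t)) / D) * y +
      (- (2 * Real.exp (- (2 * d * (1 + 2 * d) * t))) / D) * z =
      (x - 2 * Real.exp (2 * d * t) * y - 2 * Real.exp (- (2 * d * (1 + 2 * d) * t)) * z) / D := by
    intro x y z; field_simp; ring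
  have main := surv_upper a (1 / D) (- (2 * Real.exp (2 * d * t)) / D)
    (- (2 * Real.exp (- (2 * d * (1 + 2 * d) * t))) / D)
    ((1 + d) * m) m ((1 + 2 * d) * m)
    (by
      intro r
      rw [hform, div_le_one hD0]
      have p1 := hpos1 r
      have p2 := hpos2 r
      by_cases h : (r : ℝ) ≤ (1 + 2 * d) * a
      · linarith [hcase3 r h]
      · linarith [hcase2 r (not_le.1 h)])
    (by
      intro r hr
      rw [hform]
      apply div_nonpos_of_nonpos_of_nonneg _ hD0.le
      linarith [hcase1 r hr, hpos2 r]) l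
  refine main.trans ?_
  rw [hform]
  have hlow : Real.exp ((1 + d) ^ 2 * t - 1) ≤ Real.cosh ((1 + d) * m) ^ l := by
    calc _ ≤ Real.exp (l * (((1 + d) * m) ^ 2 / 2 - ((1 + d) * m) ^ 4 / 8)) := by
          apply Real.exp_le_exp.2
          have e1 : l * (((1 + d) * m) ^ 2 / 2) = (1 + d) ^ 2 * t := by
            have : l * (((1 + d) * m) ^ 2 / 2) = (1 + d) ^ 2 * (l * m ^ 2) / 2 := by ring
            rw [this, hlm]; ring
          have e2 : l * (((1 + d) * m) ^ 4 / 8) ≤ 1 := by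
            have e3 : (1 + d) ^ 4 ≤ 2 ^ 4 := by gcongr; linarith
            have e4 : l * (((1 + d) * m) ^ 4 / 8) = (1 + d) ^ 4 * (l * m ^ 2) ^ 2 / (8 * l) := by
              field_simp
            rw [e4, hlm, div_le_one (by positivity)]
            nlinarith [sq_nonneg t]
          rw [mul_sub, e1]; linarith
      _ = Real.exp (((1 + d) * m) ^ 2 / 2 - ((1 + d) * m) ^ 4 / 8) ^ l := Real.exp_nat_mul _ _
      _ ≤ _ := pow_le_pow_left₀ (Real.exp_pos _).le (exp_le_cosh _) _
  have hup : ∀ c : ℝ, Real.cosh (c * m) ^ l ≤ Real.exp (c ^ 2 * t) := by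
    intro c
    calc Real.cosh (c * m) ^ l ≤ Real.exp ((c * m) ^ 2 / 2) ^ l :=
          pow_le_pow_left₀ (Real.cosh_pos _).le (Real.cosh_le_exp_half_sq _) _
      _ = Real.exp (l * ((c * m) ^ 2 / 2)) := by rw [← Real.exp_nat_mul]
      _ = _ := by
        congr 1
        have : l * ((c * m) ^ 2 / 2) = c ^ 2 * (l * m ^ 2) / 2 := by ring
        rw [this, hlm]; ring
  have u1 : Real.exp (2 * d * t) * Real.cosh m ^ l ≤ Real.exp ((1 + 2 * d) * t) := by
    have := hup 1
    rw [one_mul] at this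
    calc _ ≤ Real.exp (2 * d * t) * Real.exp (1 ^ 2 * t) := by gcongr
      _ = _ := by rw [← Real.exp_add]; congr 1; ring
  have u2 : Real.exp (- (2 * d * (1 + 2 * d) * t)) * Real.cosh ((1 + 2 * d) * m) ^ l ≤
      Real.exp ((1 + 2 * d) * t) := by
    have := hup (1 + 2 * d)
    calc _ ≤ Real.exp (- (2 * d * (1 + 2 * d) * t)) * Real.exp ((1 + 2 * d) ^ 2 * t) := by gcongr
      _ = _ := by rw [← Real.exp_add]; congr 1; ring
  have u3 : 5 * Real.exp ((1 + 2 * d) * t) ≤ Real.exp ((1 + d) ^ 2 * t - 1) := by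
    have h5 : (5 : ℝ) ≤ Real.exp 2 := by
      have := Real.exp_one_gt_d9
      have e : Real.exp 2 = Real.exp 1 * Real.exp 1 := by rw [← Real.exp_add]; norm_num
      rw [e]; nlinarith
    calc _ ≤ Real.exp 2 * Real.exp ((1 + 2 * d) * t) := by gcongr
      _ = Real.exp (2 + (1 + 2 * d) * t) := by rw [← Real.exp_add]
      _ ≤ _ := by apply Real.exp_le_exp.2; nlinarith
  have u4 : Real.exp (- ((1 + 2 * d) ^ 2 * t)) * D = Real.exp ((1 + 2 * d) * t) := by
    rw [hD, ← Real.exp_add]; congr 1; ring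
  have : Real.exp (- ((1 + 2 * d) ^ 2 * t)) ≤ (Real.cosh ((1 + d) * m) ^ l -
      2 * Real.exp (2 * d * t) * Real.cosh m ^ l -
      2 * Real.exp (- (2 * d * (1 + 2 * d) * t)) * Real.cosh ((1 + 2 * d) * m) ^ l) / D := by
    rw [le_div_iff₀ hD0, u4]
    linarith
  linarith

instance spiderV_countable (N : ℕ) : Countable (SpiderV N) := by
  have : Function.Injective (fun v : SpiderV N => match v with
    | .body => (none : Option (ℕ × Fin N))
    | .leg r j => some (r, j)) := by
    intro a b h
    cases a <;> cases b <;> simp_all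
  exact this.countable

lemma hT_nonneg {f : ℕ → ℝ} (h : ∀ r, 0 ≤ f r) (r : ℕ) : 0 ≤ hT f r := by
  cases r with
  | zero => exact h 1
  | succ r => simp only [hT]; linarith [h r, h (r + 2)]

lemma ofReal_half (x y : ℝ) (hx : 0 ≤ x) (hy : 0 ≤ y) :
    ENNReal.ofReal x * (1 / 2) + ENNReal.ofReal y * (1 / 2) = ENNReal.ofReal ((x + y) / 2) := by
  rw [← add_mul, ← ENNReal.ofReal_add hx hy, ENNReal.ofReal_div_of_pos two_pos]
  simp [div_eq_mul_inv]

lemma spider_tsum (K : ℕ) (hK : 1 ≤ K) (f : ℕ → ℝ) (hf : ∀ r, 0 ≤ f r) (v : SpiderV K) :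
    ∑' w, ENNReal.ofReal (f (spiderHeight w)) * spiderKernel K v w =
      ENNReal.ofReal (hT f (spiderHeight v)) := by
  classical
  cases v with
  | body =>
    rw [tsum_eq_sum (s := Finset.univ.image (fun j : Fin K => SpiderV.leg 0 j))]
    · rw [Finset.sum_image (by intro a _ b _ h; simpa using h)]
      simp only [spiderKernel, spiderHeight, hT, Finset.sum_const, Finset.card_univ,
        Fintype.card_fin, nsmul_eq_mul]
      rw [mul_comm, mul_assoc, one_div, ENNReal.inv_mul_cancel]
      · simp
      · exact_mod_cast (by omega : K ≠ 0)
      · exact ENNReal.natCast_ne_top K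
    · intro w hw
      cases w with
      | body => simp [spiderKernel]
      | leg r j =>
        cases r with
        | zero => simp at hw
        | succ r => simp [spiderKernel]
  | leg r j =>
    cases r with
    | zero =>
      rw [tsum_eq_sum (s := {SpiderV.body, SpiderV.leg 1 j})]
      · rw [Finset.sum_pair (by simp)]
        simp only [spiderKernel, spiderHeight, hT]
        simpa using ofReal_half (f 0) (f 2) (hf 0) (hf 2)
      · intro w hw
        cases w with
        | body => simp at hw
        | leg r' j' =>
          simp only [spiderKernel]
          rw [if_neg, mul_zero]
          rintro ⟨rfl, h | h⟩
          · simp_all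
          · omega
    | succ r =>
      rw [tsum_eq_sum (s := {SpiderV.leg r j, SpiderV.leg (r + 2) j})]
      · rw [Finset.sum_pair (by simp)]
        simp only [spiderKernel, spiderHeight, hT]
        simpa using ofReal_half (f (r + 1)) (f (r + 3)) (hf _) (hf _)
      · intro w hw
        cases w with
        | body => simp [spiderKernel]
        | leg r' j' =>
          simp only [spiderKernel]
          rw [if_neg, mul_zero]
          rintro ⟨rfl, h | h⟩
          · simp_all
          · have : r = r' := by omega
            simp_all

/-- `A` depends only on the first `n` steps of the walk. -/
def Adp {K : ℕ} {Ω : Type} (W : ℕ → Ω → SpiderV K) (n : ℕ) (A : Set Ω) : Prop :=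
  ∀ ω ω', (∀ k ≤ n, W k ω = W k ω') → ω ∈ A → ω' ∈ A

section walk
variable {K : ℕ} {Ω : Type} [MeasurableSpace Ω] {P : Measure Ω} {W : ℕ → Ω → SpiderV K}

/-- Cylinder sets. -/
def cyl (W : ℕ → Ω → SpiderV K) (n : ℕ) (x : Fin (n + 1) → SpiderV K) : Set Ω :=
  {ω | ∀ k : Fin (n + 1), W k ω = x k}

lemma cyl_meas (hmeas : ∀ n, Measurable (W n)) (n : ℕ) (x : Fin (n + 1) → SpiderV K) :
    MeasurableSet (cyl W n x) := by
  have : cyl W n x = ⋂ k : Fin (n + 1), W k ⁻¹' {x k} := by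
    ext ω; simp [cyl]
  rw [this]
  exact MeasurableSet.iInter fun k => hmeas _ trivial

lemma adp_inter_cyl {n : ℕ} {A : Set Ω} (hA : Adp W n A) (x : Fin (n + 1) → SpiderV K) :
    A ∩ cyl W n x = ∅ ∨ A ∩ cyl W n x = cyl W n x := by
  by_cases h : (A ∩ cyl W n x).Nonempty
  · right
    obtain ⟨ω, h1, h2⟩ := h
    refine Set.inter_eq_right.2 fun ω' h' => hA ω ω' ?_ h1
    intro k hk
    exact (h2 ⟨k, by omega⟩).trans (h' ⟨k, by omega⟩).symm
  · left; exact Set.not_nonempty_iff_eq_empty.1 h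

lemma adp_union (n : ℕ) (A : Set Ω) : A = ⋃ x, A ∩ cyl W n x := by
  ext ω
  simp only [Set.mem_iUnion, Set.mem_inter_iff, exists_and_left]
  exact ⟨fun h => ⟨h, fun k => W k ω, fun k => rfl⟩, fun h => h.1⟩

lemma adp_cyl_meas (hmeas : ∀ n, Measurable (W n)) {n : ℕ} {A : Set Ω} (hA : Adp W n A)
    (x : Fin (n + 1) → SpiderV K) : MeasurableSet (A ∩ cyl W n x) := by
  rcases adp_inter_cyl hA x with h | h <;> rw [h]
  · exact MeasurableSet.empty
  · exact cyl_meas hmeas n x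

lemma adp_meas (hmeas : ∀ n, Measurable (W n)) {n : ℕ} {A : Set Ω} (hA : Adp W n A) :
    MeasurableSet A := by
  rw [adp_union (W := W) n A]
  exact MeasurableSet.iUnion (adp_cyl_meas hmeas hA)

lemma cyl_disj (n : ℕ) (A : Set Ω) :
    Pairwise (Function.onFun Disjoint fun x => A ∩ cyl W n x) := by
  intro x y hxy
  rw [Function.onFun, Set.disjoint_left]
  rintro ω ⟨_, h1⟩ ⟨_, h2⟩
  exact hxy (funext fun k => (h1 k).symm.trans (h2 k))

lemma one_step (hK : 1 ≤ K) (hmeas : ∀ n, Measurable (W n))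
    (hMarkov : ∀ n (h : ℕ → SpiderV K) (w : SpiderV K),
      P ({ω | W (n + 1) ω = w} ∩ {ω | ∀ k ≤ n, W k ω = h k})
        = spiderKernel K (h n) w * P {ω | ∀ k ≤ n, W k ω = h k})
    (f : ℕ → ℝ) (hf : ∀ r, 0 ≤ f r) (n : ℕ) (A : Set Ω) (hA : Adp W n A) :
    ∫⁻ ω in A, ENNReal.ofReal (f (spiderHeight (W (n + 1) ω))) ∂P =
      ∫⁻ ω in A, ENNReal.ofReal (hT f (spiderHeight (W n ω))) ∂P := by
  rw [adp_union (W := W) n A, lintegral_iUnion (adp_cyl_meas hmeas hA) (cyl_disj n A),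
    lintegral_iUnion (adp_cyl_meas hmeas hA) (cyl_disj n A)]
  congr 1
  ext x
  rcases adp_inter_cyl hA x with h | h <;> rw [h]
  · simp
  set v := x (Fin.last n) with hv
  have hset : cyl W n x = {ω | ∀ k ≤ n, W k ω = x ⟨min k n, by omega⟩} := by
    ext ω
    constructor
    · intro h k hk
      have := h ⟨k, by omega⟩
      simpa [min_eq_left hk] using this
    · intro h k
      have := h k (by omega)
      rw [this]; congr 1
      ext; simp; omega
  have hm := hMarkov n (fun k => x ⟨min k n, by omega⟩)
  rw [← hset] at hm
  have hvn : x ⟨min n n, by omega⟩ = v := by rw [hv]; congr 1; ext; simp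
  simp only [hvn] at hm
  have hr : ∫⁻ ω in cyl W n x, ENNReal.ofReal (hT f (spiderHeight (W n ω))) ∂P =
      ENNReal.ofReal (hT f (spiderHeight v)) * P (cyl W n x) := by
    rw [← setLIntegral_const]
    refine setLIntegral_congr_fun (cyl_meas hmeas n x) ?_
    intro ω hω
    have : W n ω = v := hω (Fin.last n)
    simp only [this]
  rw [hr]
  have hl : ∫⁻ ω in cyl W n x, ENNReal.ofReal (f (spiderHeight (W (n + 1) ω))) ∂P =
      ∫⁻ w, ENNReal.ofReal (f (spiderHeight w)) ∂((P.restrict (cyl W n x)).map (W (n + 1))) := by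
    rw [lintegral_map (measurable_from_top) (hmeas _)]
  rw [hl, lintegral_countable']
  rw [← spider_tsum K hK f hf v, ← ENNReal.tsum_mul_right]
  congr 1
  ext w
  rw [Measure.map_apply (hmeas _) (measurableSet_singleton w),
    Measure.restrict_apply (hmeas _ (measurableSet_singleton w)), mul_assoc, ← hm w]
  rfl

lemma survival (hK : 1 ≤ K) (hmeas : ∀ n, Measurable (W n))
    (hMarkov : ∀ n (h : ℕ → SpiderV K) (w : SpiderV K),
      P ({ω | W (n + 1) ω = w} ∩ {ω | ∀ k ≤ n, W k ω = h k})
        = spiderKernel K (h n) w * P {ω | ∀ k ≤ n, W k ω = h k})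
    (a : ℝ) (l n : ℕ) (A : Set Ω) (hA : Adp W n A) :
    P (A ∩ {ω | ∀ j, n ≤ j → j ≤ n + l → (spiderHeight (W j ω) : ℝ) < a}) =
      ∫⁻ ω in A, ENNReal.ofReal (surv a l (spiderHeight (W n ω))) ∂P := by
  have hA' : Adp W n (A ∩ {ω | (spiderHeight (W n ω) : ℝ) < a}) := by
    rintro ω ω' h ⟨h1, h2⟩
    refine ⟨hA ω ω' h h1, ?_⟩
    simpa [← h n le_rfl] using h2
  have hAm := adp_meas hmeas hA
  have hAm' := adp_meas hmeas hA'
  have hB : MeasurableSet {ω | (spiderHeight (W n ω) : ℝ) < a} :=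
    hmeas n (t := {v | (spiderHeight v : ℝ) < a}) trivial
  have hpull : ∀ g : ℕ → ℝ, ∫⁻ ω in A, ENNReal.ofReal
      (if (spiderHeight (W n ω) : ℝ) < a then g (spiderHeight (W n ω)) else 0) ∂P =
      ∫⁻ ω in A ∩ {ω | (spiderHeight (W n ω) : ℝ) < a},
        ENNReal.ofReal (g (spiderHeight (W n ω))) ∂P := by
    intro g
    rw [Set.inter_comm, ← setLIntegral_indicator hB]
    congr 1
    ext ω
    by_cases h : (spiderHeight (W n ω) : ℝ) < a <;> simp [Set.indicator, h]
  induction l generalizing n A with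
  | zero =>
    simp only [surv]
    rw [hpull (fun _ => 1)]
    simp only [ENNReal.ofReal_one, setLIntegral_const, one_mul, add_zero]
    congr 2
    ext ω
    exact ⟨fun h => h n le_rfl le_rfl, fun h j h1 h2 => by
      have : j = n := by omega
      subst this; exact h⟩
  | succ l ih =>
    simp only [surv]
    rw [hpull, ← one_step hK hmeas hMarkov _ (surv_nonneg a l) n _ hA']
    have hA1 : Adp W (n + 1) (A ∩ {ω | (spiderHeight (W n ω) : ℝ) < a}) :=
      fun ω ω' h => hA' ω ω' fun k hk => h k (by omega)
    have hset : A ∩ {ω | ∀ j, n ≤ j → j ≤ n + (l + 1) → (spiderHeight (W j ω) : ℝ) < a} =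
        (A ∩ {ω | (spiderHeight (W n ω) : ℝ) < a}) ∩
          {ω | ∀ j, n + 1 ≤ j → j ≤ n + 1 + l → (spiderHeight (W j ω) : ℝ) < a} := by
      ext ω
      simp only [Set.mem_inter_iff, Set.mem_ofPred_eq, and_assoc]
      refine and_congr_right fun _ => ⟨fun h => ⟨h n le_rfl (by omega), fun j h1 h2 =>
        h j (by omega) (by omega)⟩, fun h j h1 h2 => ?_⟩
      rcases Nat.eq_or_lt_of_le h1 with e | e
      · subst e; exact h.1
      · exact h.2 j e (by omega)
    rw [hset]
    have hA1' : Adp W (n + 1) ((A ∩ {ω | (spiderHeight (W n ω) : ℝ) < a}) ∩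
        {ω | (spiderHeight (W (n + 1) ω) : ℝ) < a}) := by
      rintro ω ω' h ⟨h1, h2⟩
      refine ⟨hA1 ω ω' h h1, ?_⟩
      simpa [← h (n + 1) le_rfl] using h2
    have hB1 : MeasurableSet {ω | (spiderHeight (W (n + 1) ω) : ℝ) < a} :=
      hmeas (n + 1) (t := {v | (spiderHeight v : ℝ) < a}) trivial
    refine ih (n + 1) _ hA1 hA1' hAm' (adp_meas hmeas hA1') hB1 ?_
    intro g
    rw [Set.inter_comm _ {ω | (spiderHeight (W (n + 1) ω) : ℝ) < a}, ← setLIntegral_indicator hB1]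
    congr 1
    ext ω
    by_cases h : (spiderHeight (W (n + 1) ω) : ℝ) < a <;> simp [Set.indicator, h]

end walk

section final
variable {K : ℕ} {Ω : Type} [MeasurableSpace Ω] {P : Measure Ω} [IsProbabilityMeasure P]
  {W : ℕ → Ω → SpiderV K}

lemma hit_prob (hK : 1 ≤ K) (hmeas : ∀ n, Measurable (W n))
    (h0 : ∀ ω, W 0 ω = SpiderV.body)
    (hMarkov : ∀ n (h : ℕ → SpiderV K) (w : SpiderV K),
      P ({ω | W (n + 1) ω = w} ∩ {ω | ∀ k ≤ n, W k ω = h k})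
        = spiderKernel K (h n) w * P {ω | ∀ k ≤ n, W k ω = h k})
    (a z : ℝ) (ha : 0 ≤ a) (hz : 0 < z) (l : ℕ) (hl : (l : ℝ) ≤ z) :
    P {ω | ∃ j ≤ l, a ≤ (spiderHeight (W j ω) : ℝ)} ≤
      ENNReal.ofReal (2 * Real.exp (- a ^ 2 / (2 * z))) := by
  have hA : Adp W 0 (Set.univ : Set Ω) := fun _ _ _ _ => trivial
  have h1 := survival hK hmeas hMarkov a l 0 Set.univ hA
  have hb : spiderHeight (SpiderV.body : SpiderV K) = 0 := rfl
  simp only [h0, hb, Set.univ_inter, Measure.restrict_univ, lintegral_const,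
    measure_univ, mul_one] at h1
  have hadp : Adp W l {ω | ∀ j, 0 ≤ j → j ≤ 0 + l → (spiderHeight (W j ω) : ℝ) < a} := by
    intro ω ω' h hω j hj1 hj2
    rw [← h j (by omega)]
    exact hω j hj1 hj2
  have hS := adp_meas hmeas hadp
  have hset : {ω | ∃ j ≤ l, a ≤ (spiderHeight (W j ω) : ℝ)} =
      {ω | ∀ j, 0 ≤ j → j ≤ 0 + l → (spiderHeight (W j ω) : ℝ) < a}ᶜ := by
    ext ω; simp
  rw [hset, prob_compl_eq_one_sub hS, h1, ← ENNReal.ofReal_one,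
    ← ENNReal.ofReal_sub _ (surv_nonneg a l 0)]
  apply ENNReal.ofReal_le_ofReal
  linarith [surv_zero_lower a z ha hz l hl]

lemma upper_ae (hK : 1 ≤ K) (hmeas : ∀ n, Measurable (W n))
    (h0 : ∀ ω, W 0 ω = SpiderV.body)
    (hMarkov : ∀ n (h : ℕ → SpiderV K) (w : SpiderV K),
      P ({ω | W (n + 1) ω = w} ∩ {ω | ∀ k ≤ n, W k ω = h k})
        = spiderKernel K (h n) w * P {ω | ∀ k ≤ n, W k ω = h k})
    (q : ℝ) (hq : 1 < q) :
    ∀ᵐ ω ∂P, ∀ᶠ n : ℕ in atTop, ∀ j ≤ n, (spiderHeight (W j ω) : ℝ) ≤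
      q * Real.sqrt (2 * n * Real.log (Real.log n)) := by
  have hq0 : 0 < q := by linarith
  have hlq : 0 < Real.log q := Real.log_pos hq
  set a : ℕ → ℝ := fun k => q * Real.sqrt (2 * q ^ k * Real.log (Real.log (q ^ k))) with ha
  have hbound : ∀ k : ℕ, P {ω | ∃ j ≤ ⌊q ^ (k + 1)⌋₊, a k ≤ (spiderHeight (W j ω) : ℝ)} ≤
      ENNReal.ofReal (2 * Real.exp (- a k ^ 2 / (2 * q ^ (k + 1)))) := fun k =>
    hit_prob hK hmeas h0 hMarkov (a k) (q ^ (k + 1)) (by positivity) (by positivity) _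
      (Nat.floor_le (by positivity))
  have htend : Tendsto (fun k : ℕ => (k : ℝ) * Real.log q) atTop atTop :=
    tendsto_natCast_atTop_atTop.atTop_mul_const hlq
  have hsum : Summable fun k : ℕ => 2 * Real.exp (- a k ^ 2 / (2 * q ^ (k + 1))) := by
    have hs : Summable fun k : ℕ => 2 * (Real.log q) ^ (-q) * (k : ℝ) ^ (-q) :=
      (Real.summable_nat_rpow.2 (by linarith)).mul_left _
    refine (summable_congr_atTop ?_).2 hs
    filter_upwards [htend.eventually_ge_atTop 1] with k hk
    have hk0 : 0 ≤ (k : ℝ) := Nat.cast_nonneg k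
    have e1 : Real.log (q ^ k) = k * Real.log q := by rw [Real.log_pow]
    have hL : 0 ≤ Real.log (Real.log (q ^ k)) := by rw [e1]; exact Real.log_nonneg hk
    have e2 : - a k ^ 2 / (2 * q ^ (k + 1)) = Real.log (k * Real.log q) * (-q) := by
      simp only [ha]
      rw [mul_pow, Real.sq_sqrt (by positivity), e1]
      field_simp
      ring
    rw [e2, ← Real.rpow_def_of_pos (by linarith), Real.mul_rpow hk0 hlq.le]
    ring
  have hbc := measure_limsup_atTop_eq_zero (μ := P)
    (s := fun k => {ω | ∃ j ≤ ⌊q ^ (k + 1)⌋₊, a k ≤ (spiderHeight (W j ω) : ℝ)})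
    (ne_top_of_le_ne_top hsum.tsum_ofReal_ne_top (ENNReal.tsum_le_tsum hbound))
  have hae := ae_eventually_notMem
    (ne_top_of_le_ne_top hsum.tsum_ofReal_ne_top (ENNReal.tsum_le_tsum hbound))
  filter_upwards [hae] with ω hω
  obtain ⟨k0, hk0⟩ := eventually_atTop.1 (hω.and (htend.eventually_ge_atTop 1))
  filter_upwards [tendsto_natCast_atTop_atTop.eventually_ge_atTop (q ^ (k0 + 1)),
    eventually_ge_atTop 1] with n hn hn1 j hj
  obtain ⟨k, hk1, hk2⟩ := exists_nat_pow_near (x := (n : ℝ)) (by exact_mod_cast hn1) hq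
  have hkk : k0 ≤ k := by
    have := lt_of_le_of_lt hn hk2
    have := (pow_lt_pow_iff_right₀ hq).1 this
    omega
  obtain ⟨hk3, hk4⟩ := hk0 k hkk
  have hjn : j ≤ ⌊q ^ (k + 1)⌋₊ := hj.trans (Nat.le_floor hk2.le)
  have hlt : (spiderHeight (W j ω) : ℝ) < a k := by
    by_contra hc
    exact hk3 ⟨j, hjn, not_lt.1 hc⟩
  refine hlt.le.trans ?_
  simp only [ha]
  have e1 : Real.log (q ^ k) = k * Real.log q := by rw [Real.log_pow]
  have hqk : 0 < q ^ k := by positivity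
  have hl1 : 1 ≤ Real.log (q ^ k) := by rw [e1]; exact hk4
  have hl2 : 0 ≤ Real.log (Real.log (q ^ k)) := Real.log_nonneg hl1
  have hl3 : Real.log (Real.log (q ^ k)) ≤ Real.log (Real.log n) :=
    Real.log_le_log (by linarith) (Real.log_le_log hqk hk1)
  apply mul_le_mul_of_nonneg_left _ hq0.le
  apply Real.sqrt_le_sqrt
  have : 2 * q ^ k ≤ 2 * (n : ℝ) := by linarith
  exact mul_le_mul this hl3 hl2 (by positivity)

lemma lower_bc (hK : 1 ≤ K) (hmeas : ∀ n, Measurable (W n))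
    (hMarkov : ∀ n (h : ℕ → SpiderV K) (w : SpiderV K),
      P ({ω | W (n + 1) ω = w} ∩ {ω | ∀ k ≤ n, W k ω = h k})
        = spiderKernel K (h n) w * P {ω | ∀ k ≤ n, W k ω = h k})
    (n l : ℕ → ℕ) (hn : ∀ k, n (k + 1) = n k + l k) (a p : ℕ → ℝ) (k0 : ℕ)
    (hp : ∀ k, k0 ≤ k → surv (a k) (l k) 0 ≤ 1 - p k) (hp0 : ∀ k, 0 ≤ p k)
    (hdiv : ¬ Summable p) :
    ∀ᵐ ω ∂P, ∀ m, ∃ k, m ≤ k ∧ ∃ j ≤ n (k + 1), a k ≤ (spiderHeight (W j ω) : ℝ) := by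
  have hmono : Monotone n := monotone_nat_of_le_succ fun k => by rw [hn]; omega
  set F : ℕ → Set Ω := fun k =>
    {ω | ∀ j, n k ≤ j → j ≤ n k + l k → (spiderHeight (W j ω) : ℝ) < a k} with hF
  set A : ℕ → ℕ → Set Ω := fun m N => {ω | ∀ k, m ≤ k → k < m + N → ω ∈ F k} with hAdef
  have hAadp : ∀ m N, Adp W (n (m + N)) (A m N) := by
    intro m N ω ω' h hω k hk1 hk2 j hj1 hj2
    have : j ≤ n (m + N) := by
      have h1 : n (k + 1) ≤ n (m + N) := hmono (by omega)
      rw [hn] at h1; omega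
    rw [← h j this]
    exact hω k hk1 hk2 j hj1 hj2
  have hle : ∀ m, k0 ≤ m → ∀ N, P (A m N) ≤
      ENNReal.ofReal (Real.exp (- ∑ i ∈ Finset.range N, p (m + i))) := by
    intro m hm N
    induction N with
    | zero => simpa using prob_le_one
    | succ N ih =>
      have hset : A m (N + 1) = A m N ∩ F (m + N) := by
        ext ω
        constructor
        · intro h
          exact ⟨fun k h1 h2 => h k h1 (by omega), h (m + N) (by omega) (by omega)⟩
        · rintro ⟨h1, h2⟩ k hk1 hk2
          rcases Nat.lt_succ_iff_lt_or_eq.1 (show k < (m + N) + 1 by omega) with h | h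
          · exact h1 k hk1 h
          · rw [h]; exact h2
      rw [hset, survival hK hmeas hMarkov (a (m + N)) (l (m + N)) (n (m + N)) (A m N) (hAadp m N)]
      calc _ ≤ ∫⁻ ω in A m N, ENNReal.ofReal (Real.exp (- p (m + N))) ∂P := by
            apply lintegral_mono
            intro ω
            apply ENNReal.ofReal_le_ofReal
            have h1 := surv_le_zero (a (m + N)) (l (m + N)) (spiderHeight (W (n (m + N)) ω))
            have h2 := hp (m + N) (by omega)
            have h3 := Real.add_one_le_exp (- p (m + N))
            linarith
        _ = ENNReal.ofReal (Real.exp (- p (m + N))) * P (A m N) := by rw [setLIntegral_const]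
        _ ≤ ENNReal.ofReal (Real.exp (- p (m + N))) *
            ENNReal.ofReal (Real.exp (- ∑ i ∈ Finset.range N, p (m + i))) := by gcongr
        _ = _ := by
          rw [← ENNReal.ofReal_mul (Real.exp_pos _).le, ← Real.exp_add, Finset.sum_range_succ]
          congr 2; ring
  have hzero : ∀ m, k0 ≤ m → P {ω | ∀ k, m ≤ k → ω ∈ F k} = 0 := by
    intro m hm
    have hd : ¬ Summable fun i => p (m + i) := by
      intro h
      apply hdiv
      rw [← summable_nat_add_iff m]
      simpa [add_comm] using h
    have ht := (not_summable_iff_tendsto_nat_atTop_of_nonneg (fun i => hp0 (m + i))).1 hd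
    have ht2 : Tendsto (fun N => ENNReal.ofReal
        (Real.exp (- ∑ i ∈ Finset.range N, p (m + i)))) atTop (nhds 0) := by
      have := ENNReal.tendsto_ofReal
        (Real.tendsto_exp_atBot.comp (tendsto_neg_atTop_atBot.comp ht))
      simpa using this
    refine le_antisymm (ge_of_tendsto' ht2 fun N => ?_) (zero_le)
    refine (measure_mono ?_).trans (hle m hm N)
    intro ω h k hk1 _
    exact h k hk1
  have hall : ∀ᵐ ω ∂P, ∀ m, k0 ≤ m → ¬ ∀ k, m ≤ k → ω ∈ F k := by
    rw [ae_all_iff]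
    intro m
    by_cases hm : k0 ≤ m
    · have := hzero m hm
      rw [measure_eq_zero_iff_ae_notMem] at this
      filter_upwards [this] with ω h _ using h
    · exact Eventually.of_forall fun ω h => absurd h hm
  filter_upwards [hall] with ω hω m
  have := hω (max m k0) (le_max_right _ _)
  push Not at this
  obtain ⟨k, hk1, hk2⟩ := this
  refine ⟨k, (le_max_left _ _).trans hk1, ?_⟩
  simp only [hF, Set.mem_ofPred_eq] at hk2
  push Not at hk2
  obtain ⟨j, _, h2, h3⟩ := hk2
  exact ⟨j, by rw [hn]; exact h2, h3⟩

lemma lower_ae (hK : 1 ≤ K) (hmeas : ∀ n, Measurable (W n))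
    (hMarkov : ∀ n (h : ℕ → SpiderV K) (w : SpiderV K),
      P ({ω | W (n + 1) ω = w} ∩ {ω | ∀ k ≤ n, W k ω = h k})
        = spiderKernel K (h n) w * P {ω | ∀ k ≤ n, W k ω = h k})
    (ε : ℝ) (hε : 0 < ε) (hε1 : ε < 1) :
    ∀ᵐ ω ∂P, ∃ᶠ n : ℕ in atTop, ∃ j ≤ n,
      (1 - ε) * Real.sqrt (2 * n * Real.log (Real.log n)) ≤ (spiderHeight (W j ω) : ℝ) := by
  obtain ⟨q, hqε⟩ := exists_nat_ge (max 2 (1 / ε))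
  have hq2 : (2 : ℝ) ≤ q := (le_max_left _ _).trans hqε
  have hq2' : 2 ≤ q := by exact_mod_cast hq2
  have hqe : 1 ≤ q * ε := by
    have := (le_max_right _ _).trans hqε
    rwa [div_le_iff₀ hε] at this
  have hq1 : (0 : ℝ) < q - 1 := by linarith
  have hlq : 0 < Real.log q := Real.log_pos (by linarith)
  set x : ℕ → ℝ := fun k => (q : ℝ) ^ (k + 1) with hx
  have hxt : Tendsto x atTop atTop :=
    (tendsto_pow_atTop_atTop_of_one_lt (by linarith : (1 : ℝ) < q)).comp (tendsto_add_atTop_nat 1)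
  set L : ℕ → ℝ := fun k => Real.log (Real.log (x k)) with hL
  have hLt : Tendsto L atTop atTop :=
    Real.tendsto_log_atTop.comp (Real.tendsto_log_atTop.comp hxt)
  set c : ℝ := (1 - ε) ^ 2 * q / (q - 1) with hc
  have h1e : 0 < 1 - ε := by linarith
  have hc0 : 0 < c := by positivity
  have hc1 : c ≤ 1 - ε := by
    rw [hc, div_le_iff₀ hq1]
    nlinarith
  have hlog2 : ∀ᶠ y : ℝ in atTop, 8 * q * (Real.log y) ^ 2 ≤ y := by
    have h := (Real.isLittleO_pow_log_id_atTop (n := 2)).bound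
      (show (0 : ℝ) < 1 / (8 * q) by positivity)
    filter_upwards [h, eventually_ge_atTop 0] with y hy hy0
    simp only [id, Real.norm_eq_abs, abs_of_nonneg hy0] at hy
    have := le_of_abs_le hy
    rw [div_mul_eq_mul_div, one_mul, le_div_iff₀ (by positivity)] at this
    linarith
  obtain ⟨k0, hk0⟩ := eventually_atTop.1 ((hLt.eventually_ge_atTop
    (max 1 (3 / ((ε / 8) ^ 2 * c)))).and ((hxt.eventually hlog2).and (hxt.eventually_gt_atTop 1)))
  have key := lower_bc hK hmeas hMarkov (P := P) (fun k => q ^ k) (fun k => q ^ k * (q - 1))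
    (by
      intro k
      obtain ⟨r, rfl⟩ : ∃ r, q = r + 1 := ⟨q - 1, by omega⟩
      simp only [Nat.add_sub_cancel]
      ring)
    (fun k => (1 - ε) * Real.sqrt (2 * x k * L k))
    (fun k => 1 / ((k + 1 : ℕ) : ℝ) * (1 / Real.log q)) k0
    (by
      intro k hk
      obtain ⟨hL1, hx8, hx1⟩ := hk0 k hk
      have hLone : 1 ≤ L k := (le_max_left _ _).trans hL1
      have hL3 := (le_max_right _ _).trans hL1
      rw [div_le_iff₀ (by positivity)] at hL3
      have hcast : ((q ^ k * (q - 1) : ℕ) : ℝ) = (q : ℝ) ^ k * (q - 1) := by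
        push_cast [Nat.cast_sub (show 1 ≤ q by omega)]; ring
      have hqk : (0 : ℝ) < (q : ℝ) ^ k := by positivity
      have hsq : (1 - ε) * Real.sqrt (2 * x k * L k) =
          Real.sqrt (2 * ((q ^ k * (q - 1) : ℕ) : ℝ) * (c * L k)) := by
        have e : 2 * ((q ^ k * (q - 1) : ℕ) : ℝ) * (c * L k) = (1 - ε) ^ 2 * (2 * x k * L k) := by
          rw [hcast, hc]; simp only [hx, pow_succ]; field_simp
        rw [e, Real.sqrt_mul (sq_nonneg (1 - ε)), Real.sqrt_sq h1e.le]
      have hlx : 0 < Real.log (x k) := Real.log_pos hx1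
      have hLle : L k ≤ Real.log (x k) := by
        have := Real.log_le_sub_one_of_pos hlx
        simp only [hL]; linarith
      have hcL : c * L k ≤ Real.log (x k) := by nlinarith
      have main := surv_zero_upper (q ^ k * (q - 1)) (c * L k) (ε / 8)
        (Nat.mul_pos (by positivity) (by omega)) (by positivity) (by positivity) (by linarith)
        (by linarith)
        (by
          rw [hcast]
          have h1 : (c * L k) ^ 2 ≤ Real.log (x k) ^ 2 := by
            apply pow_le_pow_left₀ (by positivity) hcL
          have h2 : q * (8 * Real.log (x k) ^ 2) ≤ q * (q : ℝ) ^ k := by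
            have : x k = q * (q : ℝ) ^ k := by simp only [hx]; ring
            rw [← this]; linarith
          have h3 := le_of_mul_le_mul_left h2 (by linarith)
          nlinarith)
      rw [hsq]
      refine main.trans ?_
      have e1 : 1 / ((k + 1 : ℕ) : ℝ) * (1 / Real.log q) = Real.exp (- L k) := by
        rw [Real.exp_neg]
        simp only [hL]
        rw [Real.exp_log hlx]
        simp only [hx]
        rw [Real.log_pow]
        field_simp
      rw [e1]
      have : Real.exp (- L k) ≤ Real.exp (- ((1 + 2 * (ε / 8)) ^ 2 * (c * L k))) := by
        apply Real.exp_le_exp.2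
        have h1 : (1 + 2 * (ε / 8)) ^ 2 * c ≤ 1 := by
          calc _ ≤ (1 + 2 * (ε / 8)) ^ 2 * (1 - ε) := by gcongr
            _ ≤ 1 := by nlinarith [mul_pos hε hε, mul_pos (mul_pos hε hε) hε]
        nlinarith
      linarith)
    (by intro k; positivity)
    (by
      intro h
      rw [summable_mul_right_iff (by positivity)] at h
      exact Real.not_summable_one_div_natCast ((summable_nat_add_iff 1).1 h))
  filter_upwards [key] with ω hω
  rw [frequently_atTop]
  intro N
  obtain ⟨k, hk, j, hj, hjk⟩ := hω N
  refine ⟨q ^ (k + 1), ?_, j, hj, ?_⟩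
  · have : k + 1 < q ^ (k + 1) := Nat.lt_pow_self (by omega)
    omega
  · simpa [hx, hL] using hjk

end final

/-- For the spider `SP(K)` with a fixed number `K` of legs, almost surely
`limsup M_K(n) / √(2 n log log n) = 1`, where `M_K(n)` is the maximal height reached on
any leg in the first `n` steps. -/
theorem spider_max_height_limsup
    (K : ℕ) (hK : 1 ≤ K)
    (Ω : Type) [MeasurableSpace Ω] (P : Measure Ω) [IsProbabilityMeasure P]
    (W : ℕ → Ω → SpiderV K)
    (hmeas : ∀ n, Measurable (W n))
    (h0 : ∀ ω, W 0 ω = SpiderV.body)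
    (hMarkov : ∀ n (h : ℕ → SpiderV K) (w : SpiderV K),
      P ({ω | W (n + 1) ω = w} ∩ {ω | ∀ k ≤ n, W k ω = h k})
        = spiderKernel K (h n) w * P {ω | ∀ k ≤ n, W k ω = h k}) :
    ∀ᵐ ω ∂P, Filter.limsup (fun n : ℕ =>
        (((Finset.range (n + 1)).sup fun t => spiderHeight (W t ω) : ℕ) : ℝ)
          / Real.sqrt (2 * n * Real.log (Real.log n))) atTop = 1 := by
  have hup : ∀ᵐ ω ∂P, ∀ m : ℕ, ∀ᶠ n : ℕ in atTop, ∀ j ≤ n, (spiderHeight (W j ω) : ℝ) ≤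
      (1 + 1 / ((m : ℝ) + 1)) * Real.sqrt (2 * n * Real.log (Real.log n)) := by
    rw [ae_all_iff]
    intro m
    apply upper_ae hK hmeas h0 hMarkov
    have : (0 : ℝ) < 1 / ((m : ℝ) + 1) := by positivity
    linarith
  have hlo : ∀ᵐ ω ∂P, ∀ m : ℕ, ∃ᶠ n : ℕ in atTop, ∃ j ≤ n,
      (1 - 1 / ((m : ℝ) + 2)) * Real.sqrt (2 * n * Real.log (Real.log n)) ≤
        (spiderHeight (W j ω) : ℝ) := by
    rw [ae_all_iff]
    intro m
    apply lower_ae hK hmeas hMarkov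
    · positivity
    · rw [div_lt_one (by positivity)]
      have : (0 : ℝ) ≤ m := Nat.cast_nonneg m
      linarith
  filter_upwards [hup, hlo] with ω h1 h2
  have hpos : ∀ᶠ n : ℕ in atTop, 0 < Real.sqrt (2 * n * Real.log (Real.log n)) := by
    have : Tendsto (fun n : ℕ => Real.log (Real.log (n : ℝ))) atTop atTop :=
      Real.tendsto_log_atTop.comp (Real.tendsto_log_atTop.comp tendsto_natCast_atTop_atTop)
    filter_upwards [this.eventually_gt_atTop 0, eventually_gt_atTop 0] with n hn hn0
    have : (0 : ℝ) < n := by exact_mod_cast hn0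
    positivity
  set u : ℕ → ℝ := fun n : ℕ =>
        (((Finset.range (n + 1)).sup fun t => spiderHeight (W t ω) : ℕ) : ℝ)
          / Real.sqrt (2 * n * Real.log (Real.log n)) with hu
  have hu0 : ∀ n, 0 ≤ u n := fun n => by simp only [hu]; positivity
  have hule : ∀ m : ℕ, ∀ᶠ n in atTop, u n ≤ 1 + 1 / ((m : ℝ) + 1) := by
    intro m
    filter_upwards [h1 m, hpos] with n hn hp
    simp only [hu]
    rw [div_le_iff₀ hp]
    obtain ⟨j, hj, hje⟩ := Finset.exists_mem_eq_sup (Finset.range (n + 1)) ⟨0, by simp⟩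
      (fun t => spiderHeight (W t ω))
    rw [hje]
    exact hn j (by simpa [Nat.lt_succ_iff] using hj)
  have huge : ∀ m : ℕ, ∃ᶠ n in atTop, 1 - 1 / ((m : ℝ) + 2) ≤ u n := by
    intro m
    refine ((h2 m).and_eventually hpos).mono ?_
    rintro n ⟨⟨j, hj, hjn⟩, hp⟩
    simp only [hu]
    rw [le_div_iff₀ hp]
    refine hjn.trans ?_
    exact_mod_cast Finset.le_sup (f := fun t => spiderHeight (W t ω))
      (Finset.mem_range.2 (Nat.lt_succ_of_le hj))
  have hbdd : IsBoundedUnder (· ≤ ·) atTop u := isBoundedUnder_of_eventually_le (hule 0)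
  have hcobdd : IsCoboundedUnder (· ≤ ·) atTop u :=
    (isBoundedUnder_of_eventually_ge (Eventually.of_forall hu0)).isCoboundedUnder_le
  apply le_antisymm
  · have ht : Tendsto (fun m : ℕ => 1 + 1 / ((m : ℝ) + 1)) atTop (nhds (1 + 0)) :=
      tendsto_const_nhds.add tendsto_one_div_add_atTop_nhds_zero_nat
    rw [add_zero] at ht
    exact ge_of_tendsto' ht fun m => limsup_le_of_le hcobdd (hule m)
  · have ht : Tendsto (fun m : ℕ => 1 - 1 / ((m : ℝ) + 2)) atTop (nhds (1 - 0)) := by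
      refine tendsto_const_nhds.sub ?_
      have := (tendsto_one_div_add_atTop_nhds_zero_nat (𝕜 := ℝ)).comp (tendsto_add_atTop_nat 1)
      refine this.congr fun m => ?_
      simp only [Function.comp]
      push_cast
      congr 1; ring
    rw [sub_zero] at ht
    exact le_of_tendsto' ht fun m => le_limsup_of_frequently_le (huge m) hbdd
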